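/- For every β > 0 and γ > 0, the third dimensionless frequency-domain derivative of the generalized Morse wavelet at its peak frequency satisfies Ψ̃₃(ω_{β,γ}) = ω_{β,γ}³·Ψ‴_{β,γ}(ω_{β,γ})/Ψ_{β,γ}(ω_{β,γ}) = −(γ−3)·βγ; in particular it vanishes exactly when γ = 3. -/

import Mathlib

/-- The generalized Morse wavelet in the frequency domain. -/
noncomputable def morsePsi (β γ : ℝ) (ω : ℝ) : ℝ :=
  if 0 < ω then 2 * (Real.exp 1 * γ / β) ^ (β / γ) * ω ^ β * Real.exp (-(ω ^ γ)) else 0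

/-- The peak frequency `ω_{β,γ} = (β/γ)^(1/γ)` of the generalized Morse wavelet. -/
noncomputable def morsePeak (β γ : ℝ) : ℝ := (β / γ) ^ (1 / γ)

lemma hasDerivAt_rpow_of_pos (γ : ℝ) {ω : ℝ} (hω : 0 < ω) :
    HasDerivAt (fun x : ℝ => x ^ γ) (γ * ω ^ γ / ω) ω := by
  convert Real.hasDerivAt_rpow_const (p := γ) (Or.inl hω.ne') using 1
  rw [Real.rpow_sub_one hω.ne', mul_div_assoc]

lemma morsePsi_pos {β γ ω : ℝ} (hβ : 0 < β) (hγ : 0 < γ) (hω : 0 < ω) :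
    0 < morsePsi β γ ω := by
  rw [morsePsi, if_pos hω]
  positivity

lemma hasDerivAt_morsePsi (β γ : ℝ) {ω : ℝ} (hω : 0 < ω) :
    HasDerivAt (morsePsi β γ) (morsePsi β γ ω * ((β - γ * ω ^ γ) / ω)) ω := by
  have h := ((hasDerivAt_rpow_of_pos β hω).const_mul
    (2 * (Real.exp 1 * γ / β) ^ (β / γ))).mul (hasDerivAt_rpow_of_pos γ hω).neg.exp
  refine (h.congr_of_eventuallyEq ?_).congr_deriv ?_
  · filter_upwards [lt_mem_nhds hω] with x hx
    simp [morsePsi, hx]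
  · simp only [morsePsi, if_pos hω, Pi.neg_apply]
    ring

lemma hasDerivAt_deriv_morsePsi (β γ : ℝ) {ω : ℝ} (hω : 0 < ω) :
    HasDerivAt (deriv (morsePsi β γ))
      (morsePsi β γ ω *
        (((β - γ * ω ^ γ) ^ 2 - (β - γ * ω ^ γ) - γ ^ 2 * ω ^ γ) / ω ^ 2)) ω := by
  have h := (hasDerivAt_morsePsi β γ hω).mul
    ((((hasDerivAt_rpow_of_pos γ hω).const_mul γ).const_sub β).div (hasDerivAt_id ω) hω.ne')
  refine (h.congr_of_eventuallyEq ?_).congr_deriv ?_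
  · filter_upwards [lt_mem_nhds hω] with x hx
    exact (hasDerivAt_morsePsi β γ hx).deriv
  · simp only [Pi.div_apply, id]
    field_simp
    ring

lemma iteratedDeriv_three_morsePsi (β γ : ℝ) {ω : ℝ} (hω : 0 < ω) :
    iteratedDeriv 3 (morsePsi β γ) ω =
      morsePsi β γ ω *
        (((β - γ * ω ^ γ) * ((β - γ * ω ^ γ) - 1) * ((β - γ * ω ^ γ) - 2)
          - 3 * ((β - γ * ω ^ γ) - 1) * (γ ^ 2 * ω ^ γ) - γ ^ 3 * ω ^ γ) / ω ^ 3) := by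
  have hu := hasDerivAt_rpow_of_pos γ hω
  have hq := (hu.const_mul γ).const_sub β
  have h := (hasDerivAt_morsePsi β γ hω).mul
    ((((hq.pow 2).sub hq).sub (hu.const_mul (γ ^ 2))).div (hasDerivAt_pow 2 ω)
      (pow_pos hω 2).ne')
  rw [iteratedDeriv_succ, iteratedDeriv_succ, iteratedDeriv_one]
  refine ((h.congr_of_eventuallyEq ?_).congr_deriv ?_).deriv
  · filter_upwards [lt_mem_nhds hω] with x hx
    exact (hasDerivAt_deriv_morsePsi β γ hx).deriv
  · simp only [Pi.div_apply, Pi.sub_apply, Pi.pow_apply]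
    field_simp
    push_cast
    ring

lemma morsePeak_rpow {β γ : ℝ} (hβ : 0 < β) (hγ : 0 < γ) : morsePeak β γ ^ γ = β / γ := by
  rw [morsePeak, ← Real.rpow_mul (by positivity), one_div_mul_cancel hγ.ne', Real.rpow_one]

/-- **Third dimensionless derivative of the generalized Morse wavelets.**
`Ψ̃₃(ω_{β,γ}) = ω_{β,γ}³·Ψ‴_{β,γ}(ω_{β,γ})/Ψ_{β,γ}(ω_{β,γ}) = −(γ−3)·βγ`, which vanishes
exactly when `γ = 3`. -/
theorem morse_third_dimensionless_derivative (β γ : ℝ) (hβ : 0 < β) (hγ : 0 < γ) :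
    (morsePeak β γ) ^ (3 : ℕ) * iteratedDeriv 3 (morsePsi β γ) (morsePeak β γ) /
        morsePsi β γ (morsePeak β γ) = -(γ - 3) * (β * γ) ∧
      ((morsePeak β γ) ^ (3 : ℕ) * iteratedDeriv 3 (morsePsi β γ) (morsePeak β γ) /
          morsePsi β γ (morsePeak β γ) = 0 ↔ γ = 3) := by
  have hω : 0 < morsePeak β γ := Real.rpow_pos_of_pos (div_pos hβ hγ) _
  have hΨ := (morsePsi_pos hβ hγ hω).ne'
  have key : (morsePeak β γ) ^ (3 : ℕ) * iteratedDeriv 3 (morsePsi β γ) (morsePeak β γ) /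
      morsePsi β γ (morsePeak β γ) = -(γ - 3) * (β * γ) := by
    rw [iteratedDeriv_three_morsePsi β γ hω, morsePeak_rpow hβ hγ, mul_div_cancel₀ β hγ.ne']
    field_simp
    ring
  refine ⟨key, ?_⟩
  rw [key, mul_eq_zero, neg_eq_zero, sub_eq_zero, or_iff_left (mul_pos hβ hγ).ne']
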